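/- arXiv:1306.3997 — 3 statements merged into one kernel-verified Lean document; each statement's English description precedes it below -/
import Mathlib

section
/- There is one and only one irreducible character of the Heisenberg group H(f) lying over λ that is invariant under the central involution ι of G(f) given by v ↦ −v. Moreover, this character is invariant under all of G(f), i.e. it is a Schrödinger character of H(f) of type λ, and its degree equals √|V| / √|V(λ)|, where V(λ) = {v ∈ V | λ(f(v,u) − f(u,v)) = 1 for all u ∈ V}. -/
namespace Paper

/-- Multiplication of the Heisenberg group `H(φ)` on `C × V`. -/
def hMul {C V : Type*} [AddCommGroup C] [AddCommGroup V] (φ : V → V → C)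
    (p q : C × V) : C × V :=
  (p.1 + q.1 + φ p.2 q.2, p.2 + q.2)

/-- Action of an additive automorphism of `V` on the Heisenberg group. -/
def hAct {C V : Type*} [AddCommGroup V] (g : V ≃+ V) (p : C × V) : C × V := (p.1, g p.2)

/-- `g` preserves the form `φ`. -/
def IsIsometry {C V : Type*} [AddCommGroup V] (φ : V → V → C) (g : V ≃+ V) : Prop :=
  ∀ u v, φ (g u) (g v) = φ u v

/-- `S` is a representation of the Heisenberg group `H(φ)`. -/
def IsRep {C V X : Type*} [AddCommGroup C] [AddCommGroup V] [AddCommGroup X] [Module ℂ X]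
    (φ : V → V → C) (S : C × V → X ≃ₗ[ℂ] X) : Prop :=
  ∀ p q, S (hMul φ p q) = S p * S q

/-- The restriction of `S` to the central subgroup `(C, 0)` is a multiple of `χ`. -/
def LiesOver {C V X : Type*} [AddCommGroup C] [AddCommGroup V] [AddCommGroup X] [Module ℂ X]
    (χ : C → ℂ) (S : C × V → X ≃ₗ[ℂ] X) : Prop :=
  ∀ c : C, (S (c, 0) : X →ₗ[ℂ] X) = χ c • (LinearMap.id : X →ₗ[ℂ] X)

/-- `S` is irreducible. -/
def IsIrred {C V X : Type*} [AddCommGroup C] [AddCommGroup V] [AddCommGroup X] [Module ℂ X]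
    (S : C × V → X ≃ₗ[ℂ] X) : Prop :=
  Nontrivial X ∧ ∀ W : Submodule ℂ X, (∀ p, ∀ x ∈ W, S p x ∈ W) → W = ⊥ ∨ W = ⊤

/-- Equivalence of representations of the Heisenberg group. -/
def AreEquivalent {C V X Y : Type*} [AddCommGroup C] [AddCommGroup V]
    [AddCommGroup X] [Module ℂ X] [AddCommGroup Y] [Module ℂ Y]
    (S₁ : C × V → X ≃ₗ[ℂ] X) (S₂ : C × V → Y ≃ₗ[ℂ] Y) : Prop :=
  ∃ T : X ≃ₗ[ℂ] Y, ∀ p x, T (S₁ p x) = S₂ p (T x)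

/-- `S` is equivalent to its conjugate under `g`. -/
def InvariantUnder {C V X : Type*} [AddCommGroup C] [AddCommGroup V]
    [AddCommGroup X] [Module ℂ X] (g : V ≃+ V) (S : C × V → X ≃ₗ[ℂ] X) : Prop :=
  AreEquivalent S fun p => S (hAct g p)

/-- `S` is a Schrödinger representation of `H(φ)` of type `χ`. -/
def IsSchrodinger {C V X : Type*} [AddCommGroup C] [AddCommGroup V]
    [AddCommGroup X] [Module ℂ X] (φ : V → V → C) (χ : C → ℂ)
    (S : C × V → X ≃ₗ[ℂ] X) : Prop :=
  IsRep φ S ∧ IsIrred S ∧ LiesOver χ S ∧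
    ∀ g : V ≃+ V, IsIsometry φ g → InvariantUnder g S

/-- `W` is a Weil representation (on the class `P` of isometries) associated to
the Schrödinger representation `S`. -/
def IsWeilOn {C V X : Type*} [AddCommGroup C] [AddCommGroup V]
    [AddCommGroup X] [Module ℂ X] (φ : V → V → C) (P : (V ≃+ V) → Prop)
    (S : C × V → X ≃ₗ[ℂ] X) (W : (V ≃+ V) → X ≃ₗ[ℂ] X) : Prop :=
  (∀ g g', P g → P g' → W (g.trans g') = W g' * W g) ∧
  (∀ g, P g → ∀ p x, W g (S p x) = S (hAct g p) (W g x))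

/-- The central involution `v ↦ -v` of `V`. -/
def negAuto (V : Type*) [AddCommGroup V] : V ≃+ V :=
  AddEquiv.mk' (Equiv.neg V) (by intro a b; show -(a + b) = -a + -b; abel)

section Heisenberg

variable {R V : Type} [AddCommGroup R] [AddCommGroup V]

/-- The Heisenberg group of a bi-additive map. -/
def Heis (_f : V →+ V →+ R) : Type := R × V

instance (f : V →+ V →+ R) : Mul (Heis f) := ⟨hMul fun u v => f u v⟩

instance (f : V →+ V →+ R) : One (Heis f) := ⟨((0, 0) : R × V)⟩

instance (f : V →+ V →+ R) : Inv (Heis f) := ⟨fun p : R × V => ((-p.1 + f p.2 p.2, -p.2) : R × V)⟩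

instance (f : V →+ V →+ R) : Group (Heis f) :=
  Group.ofLeftAxioms
    (fun a b c => Prod.ext
      (by
        show a.1 + b.1 + f a.2 b.2 + c.1 + f (a.2 + b.2) c.2 =
          a.1 + (b.1 + c.1 + f b.2 c.2) + f a.2 (b.2 + c.2)
        simp only [map_add, AddMonoidHom.add_apply]
        abel)
      (add_assoc a.2 b.2 c.2))
    (fun a => Prod.ext
      (by
        show 0 + a.1 + f 0 a.2 = a.1
        simp)
      (zero_add a.2))
    (fun a => Prod.ext
      (by
        show -a.1 + f a.2 a.2 + a.1 + f (-a.2) a.2 = 0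
        simp)
      (neg_add_cancel a.2))

instance (f : V →+ V →+ R) [Finite R] [Finite V] : Finite (Heis f) :=
  inferInstanceAs (Finite (R × V))

/-- The radical of the alternating bicharacter `(v, u) ↦ L (f v u - f u v)`. -/
def radical (f : V →+ V →+ R) (L : AddChar R ℂ) : AddSubgroup V where
  carrier := {v | ∀ u, L (f v u - f u v) = 1}
  zero_mem' u := by simp
  add_mem' {v w} hv hw u := by
    have : f (v + w) u - f u (v + w) = (f v u - f u v) + (f w u - f u w) := by
      simp only [map_add, AddMonoidHom.add_apply]
      abel
    rw [this, AddChar.map_add_eq_mul, hv u, hw u, one_mul]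
  neg_mem' {v} hv u := by
    have : f (-v) u - f u (-v) = -(f v u - f u v) := by
      simp only [map_neg, AddMonoidHom.neg_apply]
      abel
    rw [this, AddChar.map_neg_eq_inv, hv u, inv_one]

theorem mem_radical {f : V →+ V →+ R} {L : AddChar R ℂ} {v : V} :
    v ∈ radical f L ↔ ∀ u, L (f v u - f u v) = 1 := Iff.rfl

theorem exists_nsmul_add_nsmul_eq [Finite V] (hV : Odd (Nat.card V)) :
    ∃ n : ℕ, ∀ v : V, n • v + n • v = v := by
  obtain ⟨m, hm⟩ := hV
  refine ⟨m + 1, fun v => ?_⟩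
  have h : Nat.card V • v = 0 := card_nsmul_eq_zero'
  rw [hm] at h
  rw [← add_nsmul, show m + 1 + (m + 1) = 2 * m + 1 + 1 by ring, succ_nsmul, h, zero_add]

theorem AddSubgroup.exists_add_self_eq [Finite V] (hV : Odd (Nat.card V)) (K : AddSubgroup V)
    {v : V} (hv : v ∈ K) : ∃ w ∈ K, w + w = v :=
  have ⟨n, hn⟩ := exists_nsmul_add_nsmul_eq hV
  ⟨n • v, K.nsmul_mem hv _, hn v⟩

variable {X : Type} [AddCommGroup X] [Module ℂ X]

/-- The representation of `Heis f` underlying a map satisfying `IsRep`. -/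
def IsRep.toRepresentation {f : V →+ V →+ R} {S : R × V → X ≃ₗ[ℂ] X}
    (h : IsRep (fun u v => f u v) S) : Representation ℂ (Heis f) X :=
  MonoidHom.comp (LinearEquiv.automorphismGroup.toLinearMapMonoidHom)
    (MonoidHom.mk' (M := Heis f) S h)

@[simp]
theorem IsRep.toRepresentation_apply {f : V →+ V →+ R} {S : R × V → X ≃ₗ[ℂ] X}
    (h : IsRep (fun u v => f u v) S) (g : R × V) (x : X) :
    h.toRepresentation (show Heis f from g) x = S g x := rfl

theorem IsRep.apply_apply {f : V →+ V →+ R} {S : R × V → X ≃ₗ[ℂ] X}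
    (h : IsRep (fun u v => f u v) S) (p q : R × V) (x : X) :
    S p (S q x) = S (hMul (fun u v => f u v) p q) x := by
  rw [h p q]
  rfl

theorem IsIrred.isIrreducible {f : V →+ V →+ R} {S : R × V → X ≃ₗ[ℂ] X}
    (h : IsRep (fun u v => f u v) S) (hi : IsIrred S) :
    Representation.IsIrreducible h.toRepresentation where
  exists_pair_ne := by
    have := hi.1
    refine ⟨⊥, ⊤, fun he => bot_ne_top (α := Submodule ℂ X) ?_⟩
    exact congrArg Subrepresentation.toSubmodule he
  eq_bot_or_eq_top W := by
    rcases hi.2 W.toSubmodule (fun p x hx => W.apply_mem_toSubmodule p hx) with hW | hW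
    · exact Or.inl (Subrepresentation.toSubmodule_injective hW)
    · exact Or.inr (Subrepresentation.toSubmodule_injective hW)

theorem IsIrred.finiteDimensional [Finite R] [Finite V] {f : V →+ V →+ R}
    {S : R × V → X ≃ₗ[ℂ] X} (h : IsRep (fun u v => f u v) S) (hi : IsIrred S) :
    FiniteDimensional ℂ X := by
  have := hi.1
  obtain ⟨x, hx⟩ := exists_ne (0 : X)
  have hinv : ∀ p, ∀ y ∈ Submodule.span ℂ (Set.range fun q => S q x),
      S p y ∈ Submodule.span ℂ (Set.range fun q => S q x) := by
    intro p y hy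
    induction hy using Submodule.span_induction with
    | mem y hy =>
      obtain ⟨q, rfl⟩ := hy
      simp only [h.apply_apply]
      exact Submodule.subset_span ⟨_, rfl⟩
    | zero => simp
    | add y z _ _ hy hz => rw [map_add]; exact add_mem hy hz
    | smul c y _ hy => rw [map_smul]; exact Submodule.smul_mem _ _ hy
  rcases hi.2 _ hinv with hb | ht
  · have hmem : S (0, 0) x ∈ Submodule.span ℂ (Set.range fun q => S q x) :=
      Submodule.subset_span ⟨_, rfl⟩
    rw [hb, Submodule.mem_bot] at hmem
    exact absurd ((S (0, 0)).map_eq_zero_iff.1 hmem) hx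
  · exact ⟨by rw [← ht]; exact Submodule.fg_span (Set.finite_range _)⟩

/-- **Schur's lemma** for irreducible representations of Heisenberg groups. -/
theorem IsIrred.exists_eq_smul [Finite R] [Finite V] {f : V →+ V →+ R}
    {S : R × V → X ≃ₗ[ℂ] X} (h : IsRep (fun u v => f u v) S) (hi : IsIrred S)
    (A : X →ₗ[ℂ] X) (hA : ∀ p x, A (S p x) = S p (A x)) : ∃ c : ℂ, ∀ x, A x = c • x := by
  have := hi.1
  have := hi.finiteDimensional h
  obtain ⟨c, hc⟩ := Module.End.exists_eigenvalue A
  refine ⟨c, fun x => ?_⟩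
  rcases hi.2 (Module.End.eigenspace A c) (fun p x hx => by
    rw [Module.End.mem_eigenspace_iff] at hx ⊢
    rw [hA, hx, map_smul]) with hb | ht
  · exact absurd hb hc
  · exact Module.End.mem_eigenspace_iff.1 (ht ▸ Submodule.mem_top)

theorem LiesOver.apply {L : R → ℂ} {S : R × V → X ≃ₗ[ℂ] X} (hL : LiesOver L S) (c : R) (x : X) :
    S (c, 0) x = L c • x :=
  LinearMap.congr_fun (hL c) x

theorem LiesOver.apply_add {f : V →+ V →+ R} {L : R → ℂ} {S : R × V → X ≃ₗ[ℂ] X}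
    (h : IsRep (fun u v => f u v) S) (hL : LiesOver L S) (c r : R) (v : V) (x : X) :
    S (c + r, v) x = L c • S (r, v) x := by
  rw [← hL.apply c, h.apply_apply]
  simp [hMul]

theorem LiesOver.apply_comm {f : V →+ V →+ R} {L : AddChar R ℂ} {S : R × V → X ≃ₗ[ℂ] X}
    (h : IsRep (fun u v => f u v) S) (hL : LiesOver L S) (p q : R × V) (x : X) :
    S p (S q x) = L (f p.2 q.2 - f q.2 p.2) • S q (S p x) := by
  rw [h.apply_apply, h.apply_apply, hMul, hMul, ← hL.apply_add h]
  congr 2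
  refine Prod.ext ?_ (add_comm _ _)
  show p.1 + q.1 + f p.2 q.2 = f p.2 q.2 - f q.2 p.2 + (q.1 + p.1 + f q.2 p.2)
  abel

theorem LiesOver.apply_comm_of_mem_radical {f : V →+ V →+ R} {L : AddChar R ℂ}
    {S : R × V → X ≃ₗ[ℂ] X} (h : IsRep (fun u v => f u v) S) (hL : LiesOver L S) {p : R × V}
    (hp : p.2 ∈ radical f L) (q : R × V) (x : X) : S p (S q x) = S q (S p x) := by
  rw [hL.apply_comm h, hp, one_smul]

/-- `S` is trivial on the canonical lift `v + v ↦ (2 f(v, v), v + v)` of the radical to the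
Heisenberg group. -/
def TrivialOnRadical (f : V →+ V →+ R) (L : AddChar R ℂ) (S : R × V → X ≃ₗ[ℂ] X) : Prop :=
  ∀ v ∈ radical f L, ∀ x, S (f v v + f v v, v + v) x = x

theorem InvariantUnder.trivialOnRadical [Finite R] [Finite V] (hV : Odd (Nat.card V))
    {f : V →+ V →+ R} {L : AddChar R ℂ} {S : R × V → X ≃ₗ[ℂ] X}
    (h : IsRep (fun u v => f u v) S) (hi : IsIrred S) (hL : LiesOver L S)
    (hneg : InvariantUnder (negAuto V) S) : TrivialOnRadical f L S := by
  intro v hv x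
  obtain ⟨w, hw, rfl⟩ := AddSubgroup.exists_add_self_eq hV _ hv
  obtain ⟨T, hT⟩ := hneg
  set c : R := f w w + f w w with hc
  have hww := add_mem hw hw
  obtain ⟨μ, hμ⟩ := hi.exists_eq_smul h (S (c, w + w)).toLinearMap
    (fun p x => hL.apply_comm_of_mem_radical h (p := (c, w + w)) hww p x)
  have hμ' : ∀ y, S (c, w + w) y = μ • y := hμ
  have hm : ∀ y, S (c, -(w + w)) y = μ • y := by
    intro y
    have := hT (c, w + w) (T.symm y)
    rw [hμ', map_smul, T.apply_symm_apply] at this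
    exact this.symm
  have hsq : S (f (w + w) (w + w) + f (w + w) (w + w), w + w + (w + w)) x
      = S (c, w + w) (S (c, w + w) x) := by
    rw [h.apply_apply]
    congr 2
    refine Prod.ext ?_ rfl
    simp [hMul, hc]
  rw [hsq, hμ' (S _ x), ← hm, h.apply_apply]
  have : hMul (fun u v => f u v) (c, -(w + w)) (c, w + w) = (0, 0) := by
    refine Prod.ext ?_ (neg_add_cancel _)
    simp only [hMul, hc, map_add, map_neg, AddMonoidHom.add_apply, AddMonoidHom.neg_apply]
    abel
  rw [this, hL.apply, AddChar.map_zero_eq_one, one_smul]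

theorem TrivialOnRadical.apply {f : V →+ V →+ R} {L : AddChar R ℂ} {S : R × V → X ≃ₗ[ℂ] X}
    (h : IsRep (fun u v => f u v) S) (hL : LiesOver L S) (ht : TrivialOnRadical f L S) (r : R)
    {v : V} (hv : v ∈ radical f L) (x : X) :
    S (r, v + v) x = L (r - (f v v + f v v)) • x := by
  rw [← ht v hv x, ← hL.apply_add h, sub_add_cancel, ht v hv x]

theorem LiesOver.trace_eq_zero {f : V →+ V →+ R} {L : AddChar R ℂ} {S : R × V → X ≃ₗ[ℂ] X}
    (h : IsRep (fun u v => f u v) S) (hL : LiesOver L S) {p : R × V} (hp : p.2 ∉ radical f L) :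
    LinearMap.trace ℂ X (S p).toLinearMap = 0 := by
  simp only [mem_radical, not_forall] at hp
  obtain ⟨u, hu⟩ := hp
  have key : (S p).toLinearMap = L (f p.2 u - f u p.2) • (S (0, u)).conj (S p).toLinearMap := by
    ext x
    have := hL.apply_comm h p (0, u) ((S (0, u)).symm x)
    rw [LinearEquiv.apply_symm_apply] at this
    simpa [LinearEquiv.conj_apply] using this
  have htr := congrArg (LinearMap.trace ℂ X) key
  rw [map_smul, LinearMap.trace_conj', smul_eq_mul] at htr
  by_contra h0
  exact hu (mul_right_cancel₀ h0 (by rw [one_mul]; exact htr.symm))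

section Character

variable {Y : Type} [AddCommGroup Y] [Module ℂ Y] [FiniteDimensional ℂ X] [FiniteDimensional ℂ Y]

open Classical in
theorem trace_mul_trace_inv [Finite V] (hV : Odd (Nat.card V))
    {f : V →+ V →+ R} {L : AddChar R ℂ} {S : R × V → X ≃ₗ[ℂ] X} {S' : R × V → Y ≃ₗ[ℂ] Y}
    (h : IsRep (fun u v => f u v) S) (hL : LiesOver L S) (ht : TrivialOnRadical f L S)
    (h' : IsRep (fun u v => f u v) S') (hL' : LiesOver L S') (ht' : TrivialOnRadical f L S')
    (g : Heis f) :
    h.toRepresentation.character g * h'.toRepresentation.character g⁻¹ =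
      if g.2 ∈ radical f L then (Module.finrank ℂ X * Module.finrank ℂ Y : ℂ) else 0 := by
  obtain ⟨r, v⟩ := g
  split_ifs with hv
  · obtain ⟨w, hw, rfl⟩ := AddSubgroup.exists_add_self_eq hV _ hv
    have h1 : h.toRepresentation.character (show Heis f from (r, w + w)) =
        L (r - (f w w + f w w)) * Module.finrank ℂ X := by
      have : h.toRepresentation (show Heis f from (r, w + w)) =
          L (r - (f w w + f w w)) • LinearMap.id :=
        LinearMap.ext fun x => ht.apply h hL r hw x
      rw [Representation.character, this, map_smul, LinearMap.trace_id, smul_eq_mul]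
    have h2 : h'.toRepresentation.character (show Heis f from (r, w + w))⁻¹ =
        L (-r + f (w + w) (w + w) - (f w w + f w w)) * Module.finrank ℂ Y := by
      have : h'.toRepresentation (show Heis f from (r, w + w))⁻¹ =
          L (-r + f (w + w) (w + w) - (f w w + f w w)) • LinearMap.id := by
        refine LinearMap.ext fun x => ?_
        have := ht'.apply h' hL' (-r + f (w + w) (w + w)) (neg_mem hw) x
        simp only [← neg_add, map_neg, AddMonoidHom.neg_apply, neg_neg] at this
        exact this
      rw [Representation.character, this, map_smul, LinearMap.trace_id, smul_eq_mul]
    refine (congrArg₂ (· * ·) h1 h2).trans ?_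
    rw [mul_mul_mul_comm, ← AddChar.map_add_eq_mul]
    have : r - (f w w + f w w) + (-r + f (w + w) (w + w) - (f w w + f w w)) = 0 := by
      simp only [map_add, AddMonoidHom.add_apply]
      abel
    rw [this, AddChar.map_zero_eq_one, one_mul]
  · have h1 : h.toRepresentation.character (show Heis f from (r, v)) = 0 :=
      hL.trace_eq_zero h hv
    exact mul_eq_zero_of_left h1 _

theorem sum_trace_mul_trace_inv [Finite R] [Finite V] (hV : Odd (Nat.card V)) {f : V →+ V →+ R}
    [Fintype (Heis f)] {L : AddChar R ℂ} {S : R × V → X ≃ₗ[ℂ] X} {S' : R × V → Y ≃ₗ[ℂ] Y}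
    (h : IsRep (fun u v => f u v) S) (hL : LiesOver L S) (ht : TrivialOnRadical f L S)
    (h' : IsRep (fun u v => f u v) S') (hL' : LiesOver L S') (ht' : TrivialOnRadical f L S') :
    ∑ g : Heis f, h.toRepresentation.character g * h'.toRepresentation.character g⁻¹ =
      Nat.card R * Nat.card (radical f L) * (Module.finrank ℂ X * Module.finrank ℂ Y) := by
  classical
  have := Fintype.ofFinite R
  have := Fintype.ofFinite V
  rw [Finset.sum_congr rfl fun g _ => trace_mul_trace_inv hV h hL ht h' hL' ht' g]
  have : ∀ a : ℂ, ∑ g : Heis f, (if g.2 ∈ radical f L then a else 0) =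
      ∑ g : R × V, (if g.2 ∈ radical f L then a else 0) := fun a => by
    refine Fintype.sum_equiv (show Heis f ≃ R × V from Equiv.refl _) _ _ fun _ => rfl
  rw [this, Fintype.sum_prod_type]
  simp only [Finset.sum_const, ← Finset.sum_filter, Finset.card_univ, nsmul_eq_mul,
    Nat.card_eq_fintype_card, Fintype.card_subtype, mul_assoc]

theorem TrivialOnRadical.finrank_sq [Finite R] [Finite V] (hV : Odd (Nat.card V))
    {f : V →+ V →+ R} {L : AddChar R ℂ} {S : R × V → X ≃ₗ[ℂ] X}
    (h : IsRep (fun u v => f u v) S) (hi : IsIrred S) (hL : LiesOver L S)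
    (ht : TrivialOnRadical f L S) :
    Module.finrank ℂ X * Module.finrank ℂ X * Nat.card (radical f L) = Nat.card V := by
  classical
  have := Fintype.ofFinite (Heis f)
  have := hi.isIrreducible h
  have := invertibleOfNonzero (Nat.cast_ne_zero (R := ℂ).2 (Nat.card_pos (α := Heis f)).ne')
  have ho := Representation.char_orthonormal h.toRepresentation h.toRepresentation
  rw [sum_trace_mul_trace_inv hV h hL ht h hL ht,
    if_pos ⟨Representation.Equiv.refl _⟩, inv_mul_eq_one₀ (Invertible.ne_zero _)] at ho
  have hc : Nat.card (Heis f) = Nat.card R * Nat.card V := Nat.card_prod R V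
  rw [hc] at ho
  norm_cast at ho
  rw [mul_assoc] at ho
  rw [Nat.eq_of_mul_eq_mul_left Nat.card_pos ho, mul_comm]

theorem TrivialOnRadical.areEquivalent [Finite R] [Finite V] (hV : Odd (Nat.card V))
    {f : V →+ V →+ R} {L : AddChar R ℂ} {S : R × V → X ≃ₗ[ℂ] X} {S' : R × V → Y ≃ₗ[ℂ] Y}
    (h : IsRep (fun u v => f u v) S) (hi : IsIrred S) (hL : LiesOver L S)
    (ht : TrivialOnRadical f L S) (h' : IsRep (fun u v => f u v) S') (hi' : IsIrred S')
    (hL' : LiesOver L S') (ht' : TrivialOnRadical f L S') : AreEquivalent S S' := by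
  classical
  have := Fintype.ofFinite (Heis f)
  have := hi.isIrreducible h
  have := hi'.isIrreducible h'
  have := hi.1
  have := hi'.1
  have := invertibleOfNonzero (Nat.cast_ne_zero (R := ℂ).2 (Nat.card_pos (α := Heis f)).ne')
  have ho := Representation.char_orthonormal h'.toRepresentation h.toRepresentation
  rw [sum_trace_mul_trace_inv hV h' hL' ht' h hL ht] at ho
  have hne : (Nat.card (Heis f) : ℂ)⁻¹ * (Nat.card R * Nat.card (radical f L) *
      (Module.finrank ℂ Y * Module.finrank ℂ X)) ≠ 0 := by
    have h0 : Module.finrank ℂ X ≠ 0 := Module.finrank_pos.ne'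
    have h1 : Module.finrank ℂ Y ≠ 0 := Module.finrank_pos.ne'
    have h2 : Nat.card R ≠ 0 := Nat.card_pos.ne'
    have h3 : Nat.card (radical f L) ≠ 0 := Nat.card_pos.ne'
    refine mul_ne_zero (inv_ne_zero (Invertible.ne_zero _)) ?_
    exact_mod_cast mul_ne_zero (mul_ne_zero h2 h3) (mul_ne_zero h1 h0)
  rw [ho] at hne
  obtain ⟨T⟩ : Nonempty (h.toRepresentation.Equiv h'.toRepresentation) := by
    by_contra hT
    exact hne (if_neg hT)
  exact ⟨T.toLinearEquiv, fun p x => LinearMap.congr_fun (T.isIntertwining' p) x⟩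

end Character

section Isometry

variable {f : V →+ V →+ R} {g : V ≃+ V} {S : R × V → X ≃ₗ[ℂ] X}

theorem IsRep.comp_hAct (h : IsRep (fun u v => f u v) S)
    (hg : IsIsometry (fun u v => f u v) g) :
    IsRep (fun u v => f u v) fun p => S (hAct g p) := by
  intro p q
  rw [← h]
  exact congrArg S (Prod.ext (congrArg (p.1 + q.1 + ·) (hg p.2 q.2).symm) (map_add g _ _))

theorem IsIrred.comp_hAct (hi : IsIrred S) : IsIrred fun p => S (hAct g p) := by
  refine ⟨hi.1, fun W hW => hi.2 W fun p x hx => ?_⟩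
  have := hW (p.1, g.symm p.2) x hx
  simpa [hAct] using this

theorem LiesOver.comp_hAct {L : R → ℂ} (hL : LiesOver L S) :
    LiesOver L fun p => S (hAct g p) := by
  intro c
  rw [← hL c]
  simp [hAct]

theorem TrivialOnRadical.comp_hAct {L : AddChar R ℂ} (hg : IsIsometry (fun u v => f u v) g)
    (ht : TrivialOnRadical f L S) : TrivialOnRadical f L fun p => S (hAct g p) := by
  intro v hv x
  have hg' : ∀ u w, f (g u) (g w) = f u w := hg
  have hgv : g v ∈ radical f L := fun u => by
    rw [← g.apply_symm_apply u, hg', hg']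
    exact hv _
  have := ht (g v) hgv x
  rwa [hg', ← map_add g] at this

theorem isIsometry_negAuto : IsIsometry (fun u v => f u v) (negAuto V) := by
  intro u v
  show f (-u) (-v) = f u v
  simp

end Isometry

section Existence

/-- A representation of `Heis f` as a map into linear automorphisms. -/
def linearEquivOfRepresentation {f : V →+ V →+ R} (ρ : Representation ℂ (Heis f) X)
    (p : R × V) : X ≃ₗ[ℂ] X :=
  LinearEquiv.ofLinearMap (ρ (show Heis f from p)) (ρ (show Heis f from p)⁻¹)
    (by
      refine (map_mul ρ _ _).symm.trans ?_
      rw [mul_inv_cancel, map_one]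
      rfl)
    (by
      refine (map_mul ρ _ _).symm.trans ?_
      rw [inv_mul_cancel, map_one]
      rfl)

theorem isRep_linearEquivOfRepresentation {f : V →+ V →+ R} (ρ : Representation ℂ (Heis f) X) :
    IsRep (fun u v => f u v) (linearEquivOfRepresentation ρ) := fun p q =>
  LinearEquiv.toLinearMap_injective (map_mul ρ (show Heis f from p) (show Heis f from q))

/-- The representation of the Heisenberg group induced from the central character `L`. -/
def inducedRepresentation (f : V →+ V →+ R) (L : AddChar R ℂ) :
    Representation ℂ (Heis f) (V → ℂ) where
  toFun p :=
    { toFun := fun φ u => L (p.1 + f u p.2) * φ (u + p.2)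
      map_add' := fun φ ψ => by ext u; simp [mul_add]
      map_smul' := fun c φ => by ext u; simp [mul_left_comm] }
  map_one' := by
    refine LinearMap.ext fun φ => funext fun u => ?_
    show L (0 + f u 0) * φ (u + 0) = φ u
    simp
  map_mul' p q := by
    refine LinearMap.ext fun φ => funext fun u => ?_
    show L (p.1 + q.1 + f p.2 q.2 + f u (p.2 + q.2)) * φ (u + (p.2 + q.2)) =
      L (p.1 + f u p.2) * (L (q.1 + f (u + p.2) q.2) * φ (u + p.2 + q.2))
    rw [← mul_assoc, ← AddChar.map_add_eq_mul, add_assoc u]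
    congr 2
    simp only [map_add, AddMonoidHom.add_apply]
    abel

theorem liesOver_inducedRepresentation (f : V →+ V →+ R) (L : AddChar R ℂ) :
    LiesOver L (linearEquivOfRepresentation (inducedRepresentation f L)) := by
  intro c
  refine LinearMap.ext fun φ => funext fun u => ?_
  show L (c + f u 0) * φ (u + 0) = L c * φ u
  simp

theorem exists_ne_zero_trivialOnRadical [Finite V] (hV : Odd (Nat.card V)) (f : V →+ V →+ R)
    (L : AddChar R ℂ) : ∃ φ : V → ℂ, φ ≠ 0 ∧ ∀ v ∈ radical f L,
      linearEquivOfRepresentation (inducedRepresentation f L) (f v v + f v v, v + v) φ = φ := by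
  obtain ⟨n, hn⟩ := exists_nsmul_add_nsmul_eq hV
  refine ⟨fun u => L (-(f (n • u) (n • u) + f (n • u) (n • u))), fun h => ?_, fun v hv => ?_⟩
  · have := congrFun h 0
    simp at this
  · funext u
    show L (f v v + f v v + f u (v + v)) *
      L (-(f (n • (u + (v + v))) (n • (u + (v + v))) + f (n • (u + (v + v))) (n • (u + (v + v))))) =
      L (-(f (n • u) (n • u) + f (n • u) (n • u)))
    rw [smul_add n u, smul_add n v v, hn v]
    nth_rewrite 1 [← hn u]
    generalize n • u = a
    have key : f v v + f v v + f (a + a) (v + v) +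
        -(f (a + v) (a + v) + f (a + v) (a + v)) =
        -(f v a - f a v) + -(f v a - f a v) + -(f a a + f a a) := by
      simp only [map_add, AddMonoidHom.add_apply]
      abel
    rw [← AddChar.map_add_eq_mul, key, AddChar.map_add_eq_mul, AddChar.map_add_eq_mul,
      AddChar.map_neg_eq_inv, hv a]
    simp

/-- Every nonzero vector fixed by the lift of the radical yields an irreducible constituent that
is trivial on this lift. -/
theorem exists_irreducible_trivialOnRadical [FiniteDimensional ℂ X] {f : V →+ V →+ R}
    {L : AddChar R ℂ} (ρ : Representation ℂ (Heis f) X)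
    (hL : LiesOver L (linearEquivOfRepresentation ρ)) {x : X} (hx : x ≠ 0)
    (hfix : ∀ v ∈ radical f L, linearEquivOfRepresentation ρ (f v v + f v v, v + v) x = x) :
    ∃ W : Subrepresentation ρ, IsIrred (linearEquivOfRepresentation W.toRepresentation) ∧
      LiesOver L (linearEquivOfRepresentation W.toRepresentation) ∧
      TrivialOnRadical f L (linearEquivOfRepresentation W.toRepresentation) := by
  set S := linearEquivOfRepresentation ρ with hS
  have h : IsRep (fun u v => f u v) S := isRep_linearEquivOfRepresentation ρ
  let P : Submodule ℂ X :=
    { carrier := {y | ∀ v ∈ radical f L, S (f v v + f v v, v + v) y = y}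
      zero_mem' := fun v _ => map_zero _
      add_mem' := fun ha hb v hv => by rw [map_add, ha v hv, hb v hv]
      smul_mem' := fun c a ha v hv => by rw [map_smul, ha v hv] }
  have hP : ∀ p, ∀ y ∈ P, S p y ∈ P := fun p y hy v hv => by
    rw [hL.apply_comm_of_mem_radical h (p := (f v v + f v v, v + v)) (add_mem hv hv), hy v hv]
  obtain ⟨W, ⟨hW0, hWP, hW⟩, hmin⟩ := WellFounded.has_min
    (wellFounded_lt (α := Submodule ℂ X))
    {W | W ≠ ⊥ ∧ W ≤ P ∧ ∀ p, ∀ y ∈ W, S p y ∈ W}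
    ⟨P, fun hb => hx ((Submodule.mem_bot ℂ).1 (hb ▸ (show x ∈ P from hfix))), le_rfl, hP⟩
  refine ⟨⟨W, fun p y hy => hW p y hy⟩, ⟨?_, fun U hU => ?_⟩, fun c => ?_, fun v hv y => ?_⟩
  · exact Submodule.nontrivial_iff_ne_bot.2 hW0
  · by_cases hb : U = ⊥
    · exact Or.inl hb
    · right
      have hle : U.map W.subtype ≤ W := Submodule.map_subtype_le W U
      have hmem : U.map W.subtype ∈ {W | W ≠ ⊥ ∧ W ≤ P ∧ ∀ p, ∀ y ∈ W, S p y ∈ W} := by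
        refine ⟨fun h0 => hb ?_, hle.trans hWP, ?_⟩
        · exact Submodule.map_injective_of_injective W.injective_subtype (by rw [h0, Submodule.map_bot])
        · rintro p _ ⟨y, hy, rfl⟩
          exact ⟨_, hU p y hy, rfl⟩
      have heq : U.map W.subtype = W := by
        by_contra hne
        exact hmin _ hmem (lt_of_le_of_ne hle hne)
      refine Submodule.map_injective_of_injective W.injective_subtype ?_
      rw [heq, Submodule.map_subtype_top]
  · exact LinearMap.ext fun y => Subtype.ext (hL.apply c y)
  · exact Subtype.ext (hWP y.2 v hv)

end Existence

end Heisenberg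

/-- Theorem 2.1. There is one and only one irreducible character of the
Heisenberg group `H(f)` lying over `λ` that is invariant under the central involution
`ι : v ↦ -v` of `G(f)`; moreover this character is invariant under all of `G(f)`
(i.e. it is a Schrödinger character of type `λ`), and its degree equals
`√|V| / √|V(λ)|` where `V(λ) = {v | λ(f(v,u) - f(u,v)) = 1 for all u}`. -/
theorem statement0
    {R V : Type} [AddCommGroup R] [AddCommGroup V] [Finite R] [Finite V]
    (hR : Odd (Nat.card R)) (hV : Odd (Nat.card V))
    (f : V → V → R)
    (hf1 : ∀ u v w, f (u + v) w = f u w + f v w)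
    (hf2 : ∀ u v w, f u (v + w) = f u v + f u w)
    (lam : R → ℂ) (hlam : ∀ r s, lam (r + s) = lam r * lam s) (hlam0 : lam 0 = 1) :
    (∃ (X : Type) (_ : AddCommGroup X) (_ : Module ℂ X) (S : R × V → X ≃ₗ[ℂ] X),
        IsRep f S ∧ IsIrred S ∧ LiesOver lam S ∧ InvariantUnder (negAuto V) S) ∧
    (∀ (X₁ : Type) (_ : AddCommGroup X₁) (_ : Module ℂ X₁) (S₁ : R × V → X₁ ≃ₗ[ℂ] X₁)
        (X₂ : Type) (_ : AddCommGroup X₂) (_ : Module ℂ X₂) (S₂ : R × V → X₂ ≃ₗ[ℂ] X₂),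
        IsRep f S₁ → IsIrred S₁ → LiesOver lam S₁ → InvariantUnder (negAuto V) S₁ →
        IsRep f S₂ → IsIrred S₂ → LiesOver lam S₂ → InvariantUnder (negAuto V) S₂ →
        AreEquivalent S₁ S₂) ∧
    (∀ (X : Type) (_ : AddCommGroup X) (_ : Module ℂ X) (S : R × V → X ≃ₗ[ℂ] X),
        IsRep f S → IsIrred S → LiesOver lam S → InvariantUnder (negAuto V) S →
        (∀ g : V ≃+ V, IsIsometry f g → InvariantUnder g S) ∧
        (Module.finrank ℂ X : ℝ) =
          Real.sqrt (Nat.card V) /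
            Real.sqrt (Nat.card {v : V // ∀ u : V, lam (f v u - f u v) = 1})) := by
  obtain ⟨f, rfl⟩ : ∃ F : V →+ V →+ R, f = fun u v => F u v :=
    ⟨AddMonoidHom.mk' (fun u => AddMonoidHom.mk' (f u) (hf2 u))
      fun u v => AddMonoidHom.ext (hf1 u v), rfl⟩
  obtain ⟨L, rfl⟩ : ∃ L : AddChar R ℂ, lam = L := ⟨⟨lam, hlam0, hlam⟩, rfl⟩
  refine ⟨?_, ?_, ?_⟩
  · obtain ⟨φ, hφ, hfix⟩ := exists_ne_zero_trivialOnRadical hV f L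
    obtain ⟨W, hi, hL, ht⟩ := exists_irreducible_trivialOnRadical _
      (liesOver_inducedRepresentation f L) hφ hfix
    have h := isRep_linearEquivOfRepresentation W.toRepresentation
    exact ⟨W.toSubmodule, inferInstance, inferInstance, _, h, hi, hL,
      ht.areEquivalent hV h hi hL (h.comp_hAct isIsometry_negAuto) hi.comp_hAct hL.comp_hAct
        (ht.comp_hAct isIsometry_negAuto)⟩
  · intro X₁ _ _ S₁ X₂ _ _ S₂ h₁ hi₁ hL₁ hn₁ h₂ hi₂ hL₂ hn₂
    have := hi₁.finiteDimensional h₁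
    have := hi₂.finiteDimensional h₂
    exact (hn₁.trivialOnRadical hV h₁ hi₁ hL₁).areEquivalent hV h₁ hi₁ hL₁ h₂ hi₂ hL₂
      (hn₂.trivialOnRadical hV h₂ hi₂ hL₂)
  · intro X _ _ S h hi hL hn
    have := hi.finiteDimensional h
    have ht := hn.trivialOnRadical hV h hi hL
    refine ⟨fun g hg => ht.areEquivalent hV h hi hL (h.comp_hAct hg) hi.comp_hAct hL.comp_hAct
      (ht.comp_hAct hg), ?_⟩
    have hd : (Module.finrank ℂ X : ℝ) * Module.finrank ℂ X * Nat.card (radical f L) =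
        Nat.card V := by
      exact_mod_cast ht.finrank_sq hV h hi hL
    have hpos : (0 : ℝ) < Nat.card (radical f L) := by exact_mod_cast Nat.card_pos
    show _ = Real.sqrt (Nat.card V) / Real.sqrt (Nat.card (radical f L))
    rw [eq_div_iff (Real.sqrt_pos.2 hpos).ne', ← hd, Real.sqrt_mul (by positivity),
      Real.sqrt_mul_self (by positivity)]

end Paper
end

section
/- Let W : G(f⁻) → GL(X) be a Weil representation of type λ (defined relative to the Heisenberg group H(f⁻) and its isometry group G(f⁻)). Then the restriction of W to the subgroup G(f) is a Weil representation of type λ relative to H(f) and G(f). -/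
namespace Paper

/-- In a finite additive group where every element can be halved, doubling is injective. -/
theorem add_self_injective_of_half {R : Type*} [AddCommGroup R] [Finite R]
    {half : R → R} (hhalf : ∀ r, half r + half r = r) :
    Function.Injective fun r : R => r + r :=
  Finite.injective_iff_surjective.mpr fun r => ⟨half r, hhalf r⟩

/-- The change of central coordinate `r ↦ r - f(v,v)/2` turns multiplication in `H(f)` into
multiplication in `H(f⁻)`. -/
theorem hMul_sub_half {R V : Type*} [AddCommGroup R] [AddCommGroup V] [Finite R]
    {f : V → V → R}
    (hf1 : ∀ u v w, f (u + v) w = f u w + f v w)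
    (hf2 : ∀ u v w, f u (v + w) = f u v + f u w)
    {half : R → R} (hhalf : ∀ r, half r + half r = r) (p q : R × V) :
    ((hMul f p q).1 - half (f (hMul f p q).2 (hMul f p q).2), (hMul f p q).2) =
      hMul (fun u v => half (f u v - f v u))
        (p.1 - half (f p.2 p.2), p.2) (q.1 - half (f q.2 q.2), q.2) := by
  obtain ⟨r, v⟩ := p
  obtain ⟨s, w⟩ := q
  simp only [hMul, Prod.mk.injEq, and_true]
  apply add_self_injective_of_half hhalf
  have h1 := hhalf (f (v + w) (v + w))
  have h2 := hhalf (f v v)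
  have h3 := hhalf (f w w)
  have h4 := hhalf (f v w - f w v)
  have h5 : f (v + w) (v + w) = f v v + f v w + (f w v + f w w) := by
    rw [hf1, hf2, hf2]
  dsimp only
  calc
    _ = (r + r) + (s + s) + (f v w + f v w) -
        (half (f (v + w) (v + w)) + half (f (v + w) (v + w))) := by abel
    _ = (r + r) + (s + s) - (half (f v v) + half (f v v)) -
        (half (f w w) + half (f w w)) +
        (half (f v w - f w v) + half (f v w - f w v)) := by
      rw [h1, h2, h3, h4, h5]; abel
    _ = _ := by abel

/-- Proposition 2.5. If `W` is a Weil representation of `G(f⁻)` of type `λ`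
(relative to a Schrödinger representation `T` of `H(f⁻)`), then the restriction of `W` to the
subgroup `G(f) ⊆ G(f⁻)` is a Weil representation of type `λ` relative to `H(f)` and `G(f)`. -/
theorem statement3
    {R V : Type} [AddCommGroup R] [AddCommGroup V] [Finite R] [Finite V]
    (hR : Odd (Nat.card R)) (hV : Odd (Nat.card V))
    (f : V → V → R)
    (hf1 : ∀ u v w, f (u + v) w = f u w + f v w)
    (hf2 : ∀ u v w, f u (v + w) = f u v + f u w)
    (half : R → R) (hhalf : ∀ r, half r + half r = r)
    (lam : R → ℂ) (hlam : ∀ r s, lam (r + s) = lam r * lam s) (hlam0 : lam 0 = 1)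
    (X : Type) [AddCommGroup X] [Module ℂ X]
    (T : R × V → X ≃ₗ[ℂ] X) (W : (V ≃+ V) → X ≃ₗ[ℂ] X)
    (hT : IsSchrodinger (fun u v => half (f u v - f v u)) lam T)
    (hW : IsWeilOn (fun u v => half (f u v - f v u))
      (IsIsometry (fun u v => half (f u v - f v u))) T W) :
    ∃ S : R × V → X ≃ₗ[ℂ] X, IsSchrodinger f lam S ∧ IsWeilOn f (IsIsometry f) S W := by
  obtain ⟨hrep, ⟨hnt, hirr⟩, hover, hinv⟩ := hT
  have hiso : ∀ g : V ≃+ V, IsIsometry f g →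
      IsIsometry (fun u v => half (f u v - f v u)) g := by
    intro g hg u v
    simp only [hg u v, hg v u]
  refine ⟨fun p => T (p.1 - half (f p.2 p.2), p.2), ⟨?_, ⟨hnt, ?_⟩, ?_, ?_⟩, ?_, ?_⟩
  · intro p q
    dsimp only
    rw [hMul_sub_half hf1 hf2 hhalf, hrep]
  · intro U hU
    refine hirr U fun p x hx => ?_
    simpa using hU (p.1 + half (f p.2 p.2), p.2) x hx
  · intro c
    have h0 : half (f 0 0) = 0 := by
      apply add_self_injective_of_half hhalf
      have h := hf1 0 0 0
      simp only [add_zero, left_eq_add] at h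
      simp [hhalf, h]
    simpa [h0] using hover c
  · intro g hg
    obtain ⟨A, hA⟩ := hinv g (hiso g hg)
    refine ⟨A, fun p x => ?_⟩
    simpa only [hAct, hg p.2 p.2] using hA (p.1 - half (f p.2 p.2), p.2) x
  · exact fun g g' hg hg' => hW.1 g g' (hiso g hg) (hiso g' hg')
  · intro g hg p x
    simpa only [hAct, hg p.2 p.2] using hW.2 g (hiso g hg) (p.1 - half (f p.2 p.2), p.2) x

end Paper
end

section
/- Let Q : A^× → R^× be the norm map a ↦ a·a*. Then the image of Q is exactly R^{×2}, the subgroup of squares of units of R. -/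
/-- In a commutative ring of odd prime characteristic, a unit which differs from the square of a
unit by a nilpotent element is itself the square of a unit. -/
theorem exists_isUnit_mul_self_eq_sub_of_isNilpotent {R : Type*} [CommRing R]
    {p : ℕ} (hp : p.Prime) (hpodd : Odd p) [CharP R p] {r n : R}
    (hr : IsUnit r) (hn : IsNilpotent n) (hv : IsUnit (r * r - n)) :
    ∃ w : R, IsUnit w ∧ r * r - n = w * w := by
  have : Fact p.Prime := ⟨hp⟩
  obtain ⟨k, hk⟩ := hn
  obtain ⟨m, hm⟩ : Odd (p ^ k) := hpodd.pow
  have hpow : (r * r - n) ^ (p ^ k) = r ^ (p ^ k) * r ^ (p ^ k) := by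
    rw [sub_pow_char_pow, pow_eq_zero_of_le (Nat.lt_pow_self hp.one_lt).le hk, sub_zero, mul_pow]
  obtain ⟨u, rfl⟩ := hr
  refine ⟨(↑u * ↑u - n) ^ (m + 1) * ↑(u⁻¹ ^ (p ^ k)),
    (hv.pow _).mul (Units.isUnit _), ?_⟩
  have hinv : (u : R) ^ (p ^ k) * ↑(u⁻¹ ^ (p ^ k)) = 1 := by
    rw [← Units.val_pow_eq_pow_val, ← Units.val_mul, ← mul_pow, mul_inv_cancel, one_pow,
      Units.val_one]
  have hsq : (↑u * ↑u - n) ^ (m + 1) * (↑u * ↑u - n) ^ (m + 1) =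
      (↑u * ↑u - n) * ((u : R) ^ (p ^ k) * (u : R) ^ (p ^ k)) := by
    rw [← hpow, hm]
    ring
  rw [mul_mul_mul_comm, hsq, mul_assoc, mul_mul_mul_comm, hinv, mul_one, mul_one]

/-- Lemma 7.5. For the ramified quadratic extension `A` of `R` with
involution `σ`, the image of the norm map `Q : A^× → R^×`, `a ↦ a·a*`, is exactly the
subgroup of squares `R^{×2}` of `R^×`. -/
theorem statement17
    {R : Type} [CommRing R] [Finite R] [IsLocalRing R] [IsPrincipalIdealRing R]
    {p : ℕ} (hp : p.Prime) (hpodd : Odd p) [CharP R p]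
    (x : R) (hx : IsLocalRing.maximalIdeal R = Ideal.span {x})
    (ℓ : ℕ) (hℓ : 1 ≤ ℓ) (hxnil : x ^ ℓ = 0) (hxpow : x ^ (ℓ - 1) ≠ 0)
    {A : Type} [CommRing A] [Algebra R A]
    (y : A) (hy : y * y = algebraMap R A x)
    (hAfree : ∀ a : A, ∃! rs : R × R,
      a = algebraMap R A rs.1 + algebraMap R A rs.2 * y)
    (σ : A ≃+* A)
    (hσ : ∀ r s : R, σ (algebraMap R A r + algebraMap R A s * y) =
      algebraMap R A r - algebraMap R A s * y)
    :
    {b : A | ∃ a : A, IsUnit a ∧ b = a * σ a} =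
      {b : A | ∃ r : R, IsUnit r ∧ b = algebraMap R A (r * r)} := by
  have hinj : Function.Injective (algebraMap R A) := by
    intro a b hab
    exact congrArg Prod.fst ((hAfree (algebraMap R A a)).unique
      (y₁ := (a, 0)) (y₂ := (b, 0)) (by simp) (by simp [hab]))
  have : Nontrivial A := hinj.nontrivial
  have hxmem : x ∈ IsLocalRing.maximalIdeal R := hx ▸ Ideal.mem_span_singleton_self x
  have hnil : ∀ s : R, IsNilpotent (s * s * x) := fun s => ⟨ℓ, by rw [mul_pow, hxnil, mul_zero]⟩
  have hunit : ∀ v : R, IsUnit (algebraMap R A v) → IsUnit v := by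
    intro v hv
    by_contra h
    have hvx : v ∈ Ideal.span {x} := hx ▸ (IsLocalRing.mem_maximalIdeal v).2 h
    obtain ⟨c, rfl⟩ := Ideal.mem_span_singleton.1 hvx
    have h0 := hv.pow ℓ
    rw [← map_pow, mul_pow, hxnil, zero_mul, map_zero] at h0
    exact not_isUnit_zero h0
  have hnorm : ∀ r s : R, (algebraMap R A r + algebraMap R A s * y) *
      σ (algebraMap R A r + algebraMap R A s * y) = algebraMap R A (r * r - s * s * x) := by
    intro r s
    rw [hσ, map_sub, map_mul, map_mul, map_mul, ← hy]
    ring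
  ext b
  constructor
  · rintro ⟨a, ha, rfl⟩
    obtain ⟨⟨r, s⟩, rfl, -⟩ := hAfree a
    have hv : IsUnit (r * r - s * s * x) := hunit _ (hnorm r s ▸ ha.mul (ha.map σ))
    have hr : IsUnit r := by
      by_contra h
      refine (IsLocalRing.mem_maximalIdeal _).1 ?_ hv
      exact sub_mem (Ideal.mul_mem_left _ _ ((IsLocalRing.mem_maximalIdeal r).2 h))
        (Ideal.mul_mem_left _ _ hxmem)
    obtain ⟨w, hw, hvw⟩ :=
      exists_isUnit_mul_self_eq_sub_of_isNilpotent hp hpodd hr (hnil s) hv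
    exact ⟨w, hw, by rw [← hvw]; exact hnorm r s⟩
  · rintro ⟨r, hr, rfl⟩
    refine ⟨algebraMap R A r, hr.map _, ?_⟩
    simpa using (hnorm r 0).symm
end
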